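/- arXiv:math/9807074 — 3 statements merged into one kernel-verified Lean document; each statement's English description precedes it below -/
import Mathlib

section
/- For all real numbers x, y, t, s with |x*y*t*s| < 1, the double series ∑_{m,n≥0} H_{m,n}(x) H_{m,n}(y) t^m s^n / (m! n!) converges (as a sum over ℕ × ℕ) and its sum equals (1 - x y t s)⁻¹ · exp((t + s + x t s + y t s) / (1 - x y t s)). -/
/-- The straight Hermite polynomial
`H_{m,n}(x) = ∑_{k=0}^{min(m,n)} C(m,k) C(n,k) k! x^k`. -/
def straightHermite (m n : ℕ) (x : ℝ) : ℝ :=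
  ∑ k ∈ Finset.range (min m n + 1),
    (Nat.choose m k : ℝ) * (Nat.choose n k : ℝ) * (Nat.factorial k : ℝ) * x ^ k

/-- The homogenized straight Hermite polynomial
`∑ k, C(m,k) C(n,k) k! x^k u^(m-k) v^(n-k)`. -/
def homogeneousHermite (m n : ℕ) (x u v : ℝ) : ℝ :=
  ∑ k ∈ Finset.range (m + 1),
    (m.choose k : ℝ) * (n.choose k : ℝ) * (k.factorial : ℝ) * x ^ k * u ^ (m - k) * v ^ (n - k)

theorem straightHermite_eq_homogeneousHermite (m n : ℕ) (x : ℝ) :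
    straightHermite m n x = homogeneousHermite m n x 1 1 := by
  simp only [straightHermite, homogeneousHermite, one_pow, mul_one]
  refine Finset.sum_subset (fun k hk => ?_) fun k hk hk' => ?_
  · simp only [Finset.mem_range] at *; omega
  · simp only [Finset.mem_range] at *
    rw [Nat.choose_eq_zero_of_lt (show n < k by omega)]
    simp

theorem homogeneousHermite_zero_left (n : ℕ) (x u v : ℝ) :
    homogeneousHermite 0 n x u v = v ^ n := by
  simp [homogeneousHermite]

theorem homogeneousHermite_succ_left (m n : ℕ) (x u v : ℝ) :
    homogeneousHermite (m + 1) n x u v =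
      u * homogeneousHermite m n x u v + x * n * homogeneousHermite m (n - 1) x u v := by
  have extend : homogeneousHermite m n x u v = ∑ k ∈ Finset.range (m + 2),
      (m.choose k : ℝ) * (n.choose k : ℝ) * (k.factorial : ℝ) * x ^ k * u ^ (m - k) *
        v ^ (n - k) := by
    rw [Finset.sum_range_succ]
    simp [homogeneousHermite]
  rw [extend, homogeneousHermite, homogeneousHermite, Finset.sum_range_succ',
    Finset.sum_range_succ' _ (m + 1), mul_add, add_right_comm, Finset.mul_sum, Finset.mul_sum,
    ← Finset.sum_add_distrib]
  congr 1
  · refine Finset.sum_congr rfl fun k hk => ?_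
    have hn : (n.choose (k + 1) : ℝ) * (k + 1) = n * ((n - 1).choose k : ℝ) := by
      cases n with
      | zero => simp
      | succ n => exact_mod_cast (Nat.add_one_mul_choose_eq n k).symm
    have hu : (m.choose (k + 1) : ℝ) * u ^ (m - k) =
        m.choose (k + 1) * (u * u ^ (m - (k + 1))) := by
      rcases (Nat.lt_succ_iff.mp (Finset.mem_range.mp hk)).eq_or_lt with rfl | hlt
      · simp
      · rw [← pow_succ', show m - (k + 1) + 1 = m - k by omega]
    rw [Nat.choose_succ_succ, Nat.factorial_succ, Nat.add_sub_add_right,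
      show n - (k + 1) = n - 1 - k by omega]
    push_cast
    linear_combination (n.choose (k + 1) : ℝ) * (k + 1) * k.factorial * x ^ (k + 1) *
      v ^ (n - 1 - k) * hu + (m.choose k : ℝ) * k.factorial * x ^ (k + 1) * u ^ (m - k) *
      v ^ (n - 1 - k) * hn
  · simp [pow_succ']
    ring

theorem straightHermite_comm (m n : ℕ) (x : ℝ) :
    straightHermite m n x = straightHermite n m x := by
  simp only [straightHermite, min_comm m n, mul_comm (m.choose _ : ℝ)]

theorem abs_straightHermite_le (m n : ℕ) (x : ℝ) :
    |straightHermite m n x| ≤ straightHermite m n |x| := by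
  refine (Finset.abs_sum_le_sum_abs _ _).trans_eq (Finset.sum_congr rfl fun k _ => ?_)
  simp [abs_mul]

theorem straightHermite_succ_left (m n : ℕ) (x : ℝ) :
    straightHermite (m + 1) n x =
      straightHermite m n x + x * n * straightHermite m (n - 1) x := by
  simp only [straightHermite_eq_homogeneousHermite, homogeneousHermite_succ_left, one_mul]

theorem HasSum.of_eq {ι : Type*} {f g : ι → ℝ} {a b : ℝ} (h : HasSum f a)
    (hfg : ∀ i, g i = f i) (hab : b = a) : HasSum g b := by
  rwa [funext hfg, hab]

theorem HasSum.mul_prod {ι κ : Type*} {f : ι → ℝ} {g : κ → ℝ} {a b : ℝ} (hf : HasSum f a)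
    (hg : HasSum g b) : HasSum (fun p : ι × κ => f p.1 * g p.2) (a * b) :=
  hf.mul hg (summable_mul_of_summable_norm hf.summable.norm hg.summable.norm)

/-- Evaluate a dominated double series by iterated summation. -/
theorem hasSum_prod_of_abs_le {β γ : Type*} {f F : β × γ → ℝ} {g G : β → ℝ} {S : ℝ}
    (hle : ∀ p, |f p| ≤ F p) (hF : ∀ b, HasSum (fun c => F (b, c)) (G b)) (hG : Summable G)
    (hf : ∀ b, HasSum (fun c => f (b, c)) (g b)) (hg : HasSum g S) : HasSum f S := by
  have hFs : Summable F := by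
    refine (summable_prod_of_nonneg fun p => (abs_nonneg _).trans (hle p)).2
      ⟨fun b => (hF b).summable, ?_⟩
    simpa only [(hF _).tsum_eq] using hG
  have hfs : Summable f := Summable.of_norm_bounded hFs hle
  have := hfs.hasSum.prod_fiberwise hf
  rw [hg.unique this]
  exact hfs.hasSum

/-- Reindex a triple series by `(l, a, b) ↦ (a + l, b + l)`. -/
theorem HasSum.sum_diagonal_shift {g : ℕ → ℕ → ℕ → ℝ} {S : ℝ}
    (hg : HasSum (fun p : ℕ × ℕ × ℕ => g p.1 p.2.1 p.2.2) S) :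
    HasSum (fun p : ℕ × ℕ => ∑ l ∈ Finset.range (min p.1 p.2 + 1), g l (p.1 - l) (p.2 - l)) S := by
  let e : ℕ × ℕ × ℕ → (ℕ × ℕ) × ℕ := fun p => ((p.2.1 + p.1, p.2.2 + p.1), p.1)
  have he : Function.Injective e := by
    rintro ⟨l, a, b⟩ ⟨l', a', b'⟩ h
    simp only [e, Prod.mk.injEq] at h ⊢
    omega
  let f : (ℕ × ℕ) × ℕ → ℝ := fun p =>
    if p.2 ≤ min p.1.1 p.1.2 then g p.2 (p.1.1 - p.2) (p.1.2 - p.2) else 0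
  have hf : HasSum f S := by
    refine (he.hasSum_iff fun p hp => ?_).1 (hg.of_eq ?_ rfl)
    · refine if_neg fun h => hp ⟨(p.2, p.1.1 - p.2, p.1.2 - p.2), ?_⟩
      ext <;> simp only [e] <;> omega
    · rintro ⟨l, a, b⟩
      simp [f, e]
  refine hf.prod_fiberwise fun p => ?_
  have := hasSum_sum_of_ne_finset_zero (f := fun l => f (p, l))
    (s := Finset.range (min p.1 p.2 + 1)) (L := SummationFilter.unconditional _)
    fun l hl => if_neg (by simpa [Nat.lt_succ_iff] using hl)
  refine this.of_eq (fun _ => rfl) ?_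
  refine Finset.sum_congr rfl fun l hl => (if_pos ?_).symm
  exact Nat.lt_succ_iff.mp (Finset.mem_range.mp hl)

theorem Real.hasSum_exp (x : ℝ) : HasSum (fun n : ℕ => x ^ n / (n.factorial : ℝ)) (Real.exp x) := by
  rw [Real.exp_eq_exp_ℝ]
  exact NormedSpace.expSeries_div_hasSum_exp x

theorem hasSum_straightHermite (x t s : ℝ) :
    HasSum (fun p : ℕ × ℕ => straightHermite p.1 p.2 x * t ^ p.1 * s ^ p.2 /
      ((p.1.factorial : ℝ) * (p.2.factorial : ℝ))) (Real.exp (t + s + x * t * s)) := by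
  have hexp := (Real.hasSum_exp (x * t * s)).mul_prod
    ((Real.hasSum_exp t).mul_prod (Real.hasSum_exp s))
  have hsum := HasSum.sum_diagonal_shift (g := fun l a b => (x * t * s) ^ l / (l.factorial : ℝ) *
    (t ^ a / (a.factorial : ℝ) * (s ^ b / (b.factorial : ℝ)))) hexp
  refine hsum.of_eq ?_ ?_
  · rintro ⟨m, n⟩
    simp only [straightHermite, Finset.sum_mul, Finset.sum_div]
    refine Finset.sum_congr rfl fun k hk => ?_
    have hk' : k ≤ m ∧ k ≤ n := by simpa [Nat.lt_succ_iff] using hk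
    obtain ⟨a, rfl⟩ := Nat.exists_eq_add_of_le hk'.1
    obtain ⟨b, rfl⟩ := Nat.exists_eq_add_of_le hk'.2
    rw [Nat.cast_add_choose ℝ, Nat.cast_add_choose ℝ, Nat.add_sub_cancel_left,
      Nat.add_sub_cancel_left]
    field_simp
    ring
  · rw [← Real.exp_add, ← Real.exp_add]
    ring_nf

/-- The summand of the exponential generating function of `(a, b) ↦ H_{a+p,b+q}(x)`. -/
noncomputable def shiftedHermiteTerm (x t s : ℝ) (p q : ℕ) (c : ℕ × ℕ) : ℝ :=
  straightHermite (c.1 + p) (c.2 + q) x * t ^ c.1 * s ^ c.2 /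
    ((c.1.factorial : ℝ) * (c.2.factorial : ℝ))

theorem hasSum_shiftedHermiteTerm_succ_left {x t s A B : ℝ} {p q : ℕ}
    (hA : HasSum (shiftedHermiteTerm x t s p q) A)
    (hB : HasSum (shiftedHermiteTerm x t s p (q - 1)) B) :
    HasSum (shiftedHermiteTerm x t s (p + 1) q) ((1 + x * s) * A + x * q * B) := by
  let f : ℕ × ℕ → ℝ := fun c => c.2 * (straightHermite (c.1 + p) (c.2 - 1 + q) x *
    t ^ c.1 * s ^ c.2 / ((c.1.factorial : ℝ) * (c.2.factorial : ℝ)))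
  have hf : HasSum f (s * A) := by
    refine ((Function.injective_id.prodMap Nat.succ_injective).hasSum_iff fun c hc => ?_).1
      ((hA.mul_left s).of_eq ?_ rfl)
    · rcases c with ⟨a, _ | b⟩
      · simp [f]
      · exact absurd ⟨(a, b), rfl⟩ hc
    · rintro ⟨a, b⟩
      simp only [f, shiftedHermiteTerm, Function.comp, Prod.map, id, Nat.succ_eq_add_one,
        Nat.add_sub_cancel, Nat.factorial_succ]
      push_cast
      field_simp
      ring
  have := (hA.add (hf.mul_left x)).add (hB.mul_left (x * q))
  refine this.of_eq ?_ ?_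
  · rintro ⟨a, b⟩
    have hb : (b : ℝ) * straightHermite (a + p) (b + q - 1) x =
        b * straightHermite (a + p) (b - 1 + q) x := by
      rcases b with _ | b
      · simp
      · rw [show b + 1 + q - 1 = b + 1 - 1 + q by omega]
    have hq : (q : ℝ) * straightHermite (a + p) (b + q - 1) x =
        q * straightHermite (a + p) (b + (q - 1)) x := by
      rcases q with _ | q
      · simp
      · rfl
    simp only [shiftedHermiteTerm, f]
    rw [← add_assoc, straightHermite_succ_left]
    push_cast
    linear_combination x * t ^ a * s ^ b / ((a.factorial : ℝ) * (b.factorial : ℝ)) * (hb + hq)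
  · ring

theorem hasSum_shiftedHermiteTerm (x t s : ℝ) (p q : ℕ) :
    HasSum (shiftedHermiteTerm x t s p q)
      (Real.exp (t + s + x * t * s) *
        homogeneousHermite p q x (1 + x * s) (1 + x * t)) := by
  have base : ∀ (t s : ℝ) (p : ℕ), HasSum (shiftedHermiteTerm x t s p 0)
      (Real.exp (t + s + x * t * s) * (1 + x * s) ^ p) := by
    intro t s p
    induction p with
    | zero => exact (hasSum_straightHermite x t s).of_eq (fun _ => rfl) (by simp)
    | succ p ih =>
      refine (hasSum_shiftedHermiteTerm_succ_left ih ih).of_eq (fun _ => rfl) ?_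
      push_cast
      ring
  induction p generalizing q with
  | zero =>
    rw [homogeneousHermite_zero_left]
    refine ((Equiv.prodComm ℕ ℕ).hasSum_iff.2 (base s t q)).of_eq ?_ ?_
    · rintro ⟨a, b⟩
      simp only [shiftedHermiteTerm, Function.comp, Equiv.prodComm_apply, Prod.swap_prod_mk]
      rw [straightHermite_comm]
      ring
    · ring_nf
  | succ p ih =>
    refine (hasSum_shiftedHermiteTerm_succ_left (ih q) (ih (q - 1))).of_eq (fun _ => rfl) ?_
    rw [homogeneousHermite_succ_left]
    ring

theorem hasSum_choose_mul_pow_mul_pow_div_factorial (z r : ℝ) (hr : |r| < 1) :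
    HasSum (fun p : ℕ × ℕ => z ^ p.1 / (p.1.factorial : ℝ) *
      (((p.2 + p.1).choose p.1 : ℝ) * r ^ p.2))
      ((1 - r)⁻¹ * Real.exp (z / (1 - r))) := by
  have inner : ∀ z r : ℝ, |r| < 1 → ∀ i : ℕ,
      HasSum (fun j : ℕ => z ^ i / (i.factorial : ℝ) * (((j + i).choose i : ℝ) * r ^ j))
        ((1 - r)⁻¹ * ((z / (1 - r)) ^ i / (i.factorial : ℝ))) := by
    intro z r hr i
    refine ((hasSum_choose_mul_geometric_of_norm_lt_one i (r := r) hr).mul_left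
      (z ^ i / (i.factorial : ℝ))).of_eq (fun _ => rfl) ?_
    rw [div_pow, pow_succ]
    field_simp
  have outer : ∀ z r : ℝ, HasSum
      (fun i : ℕ => (1 - r)⁻¹ * ((z / (1 - r)) ^ i / (i.factorial : ℝ)))
      ((1 - r)⁻¹ * Real.exp (z / (1 - r))) := fun z r =>
    (Real.hasSum_exp (z / (1 - r))).mul_left (1 - r)⁻¹
  refine hasSum_prod_of_abs_le (F := fun p : ℕ × ℕ => |z| ^ p.1 / (p.1.factorial : ℝ) *
    (((p.2 + p.1).choose p.1 : ℝ) * |r| ^ p.2)) (fun p => le_of_eq ?_)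
    (inner |z| |r| (by rwa [abs_abs])) (outer |z| |r|).summable (inner z r hr) (outer z r)
  simp [abs_mul, abs_div]

theorem hasSum_homogeneousHermite_diagonal (x u v w : ℝ) (h : |x * w| < 1) :
    HasSum (fun l : ℕ => w ^ l / (l.factorial : ℝ) * homogeneousHermite l l x u v)
      ((1 - x * w)⁻¹ * Real.exp (u * v * w / (1 - x * w))) := by
  have h1 := hasSum_choose_mul_pow_mul_pow_div_factorial (u * v * w) (x * w) h
  refine ((Finset.HasAntidiagonal.sigmaAntidiagonalEquivProd.hasSum_iff.2 h1).sigma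
    fun l => hasSum_fintype _).of_eq (fun l => ?_) (by ring_nf)
  rw [Finset.univ_eq_attach]
  simp only [Function.comp, Finset.HasAntidiagonal.sigmaAntidiagonalEquivProd_apply]
  rw [Finset.sum_attach (Finset.HasAntidiagonal.antidiagonal l) fun p =>
      (u * v * w) ^ p.1 / (p.1.factorial : ℝ) * (((p.2 + p.1).choose p.1 : ℝ) * (x * w) ^ p.2), ← Finset.Nat.sum_antidiagonal_swap,
    Finset.Nat.sum_antidiagonal_eq_sum_range_succ_mk, homogeneousHermite, Finset.mul_sum]
  refine Finset.sum_congr rfl fun k hk => ?_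
  obtain ⟨i, rfl⟩ := Nat.exists_eq_add_of_le (Nat.lt_succ_iff.mp (Finset.mem_range.mp hk))
  simp only [Prod.swap_prod_mk, Nat.add_sub_cancel_left]
  rw [← Nat.choose_symm_add, Nat.cast_add_choose ℝ]
  field_simp
  ring

/-- The heterosexual Mehler formula. -/
theorem heterosexual_mehler (x y t s : ℝ) (h : |x * y * t * s| < 1) :
    HasSum
      (fun p : ℕ × ℕ =>
        straightHermite p.1 p.2 x * straightHermite p.1 p.2 y * t ^ p.1 * s ^ p.2 /
          ((Nat.factorial p.1 : ℝ) * (Nat.factorial p.2 : ℝ)))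
      ((1 - x * y * t * s)⁻¹ *
        Real.exp ((t + s + x * t * s + y * t * s) / (1 - x * y * t * s))) := by
  have inner : ∀ (x y t s : ℝ) (l : ℕ), HasSum
      (fun c : ℕ × ℕ => (y * t * s) ^ l / (l.factorial : ℝ) * shiftedHermiteTerm x t s l l c)
      (Real.exp (t + s + x * t * s) * ((y * t * s) ^ l / (l.factorial : ℝ) *
        homogeneousHermite l l x (1 + x * s) (1 + x * t))) := by
    intro x y t s l
    refine ((hasSum_shiftedHermiteTerm x t s l l).mul_left
      ((y * t * s) ^ l / (l.factorial : ℝ))).of_eq (fun _ => rfl) ?_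
    ring
  have outer : ∀ x y t s : ℝ, |x * y * t * s| < 1 → HasSum
      (fun l : ℕ => Real.exp (t + s + x * t * s) * ((y * t * s) ^ l / (l.factorial : ℝ) *
        homogeneousHermite l l x (1 + x * s) (1 + x * t)))
      ((1 - x * y * t * s)⁻¹ *
        Real.exp ((t + s + x * t * s + y * t * s) / (1 - x * y * t * s))) := by
    intro x y t s h
    have hxw : x * (y * t * s) = x * y * t * s := by ring
    have hne : 1 - x * y * t * s ≠ 0 := by linarith [(abs_lt.1 h).2]
    refine ((hasSum_homogeneousHermite_diagonal x (1 + x * s) (1 + x * t) (y * t * s)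
      (by rwa [hxw])).mul_left (Real.exp (t + s + x * t * s))).of_eq (fun _ => rfl) ?_
    rw [hxw, mul_left_comm, ← Real.exp_add]
    congr 2
    rw [div_eq_iff hne, add_mul, div_mul_cancel₀ _ hne]
    ring
  have triple : HasSum (fun p : ℕ × ℕ × ℕ => (y * t * s) ^ p.1 / (p.1.factorial : ℝ) *
      shiftedHermiteTerm x t s p.1 p.1 (p.2.1, p.2.2))
      ((1 - x * y * t * s)⁻¹ *
        Real.exp ((t + s + x * t * s + y * t * s) / (1 - x * y * t * s))) := by
    refine hasSum_prod_of_abs_le (F := fun p : ℕ × ℕ × ℕ =>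
      (|y| * |t| * |s|) ^ p.1 / (p.1.factorial : ℝ) *
        shiftedHermiteTerm |x| |t| |s| p.1 p.1 p.2) (fun p => ?_) (inner |x| |y| |t| |s|)
      (outer |x| |y| |t| |s| (by simpa [abs_mul] using h)).summable (inner x y t s) (outer x y t s h)
    simp only [shiftedHermiteTerm, abs_mul, abs_div, abs_pow, Nat.abs_cast]
    gcongr
    exact abs_straightHermite_le _ _ _
  refine (HasSum.sum_diagonal_shift (g := fun l a b => (y * t * s) ^ l / (l.factorial : ℝ) *
    shiftedHermiteTerm x t s l l (a, b)) triple).of_eq ?_ rfl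
  rintro ⟨m, n⟩
  simp only [straightHermite.eq_1 m n y, Finset.mul_sum, Finset.sum_mul, Finset.sum_div]
  refine Finset.sum_congr rfl fun k hk => ?_
  have hk' : k ≤ m ∧ k ≤ n := by simpa [Nat.lt_succ_iff] using hk
  obtain ⟨a, rfl⟩ := Nat.exists_eq_add_of_le hk'.1
  obtain ⟨b, rfl⟩ := Nat.exists_eq_add_of_le hk'.2
  simp only [shiftedHermiteTerm, Nat.add_sub_cancel_left, add_comm _ k]
  rw [Nat.cast_add_choose ℝ, Nat.cast_add_choose ℝ]
  field_simp
  ring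
end

section
/- For all real numbers x, t, s, the double series ∑_{m,n≥0} H_{m,n}(x) t^m s^n / (m! n!) converges (as a sum over ℕ × ℕ) and its sum equals exp(t + s + x t s). -/
/-- The term of index `k` of `H_{m,n}(x) t^m s^n / (m! n!)`, at `((m, n), k)`. -/
noncomputable def straightHermiteTerm (x t s : ℝ) (q : (ℕ × ℕ) × ℕ) : ℝ :=
  (Nat.choose q.1.1 q.2 : ℝ) * (Nat.choose q.1.2 q.2 : ℝ) * (Nat.factorial q.2 : ℝ) * x ^ q.2 *
    t ^ q.1.1 * s ^ q.1.2 / ((Nat.factorial q.1.1 : ℝ) * (Nat.factorial q.1.2 : ℝ))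

theorem straightHermiteTerm_add (x t s : ℝ) (a b k : ℕ) :
    straightHermiteTerm x t s ((a + k, b + k), k) =
      t ^ a / (Nat.factorial a : ℝ) * (s ^ b / (Nat.factorial b : ℝ)) *
        ((x * t * s) ^ k / (Nat.factorial k : ℝ)) := by
  have factorial_ne (n : ℕ) : (Nat.factorial n : ℝ) ≠ 0 :=
    Nat.cast_ne_zero.mpr (Nat.factorial_ne_zero n)
  have ha := factorial_ne a
  have hb := factorial_ne b
  have hk := factorial_ne k
  have hak := factorial_ne (a + k)
  have hbk := factorial_ne (b + k)
  have choose_eq (n : ℕ) : (Nat.choose (n + k) k : ℝ) =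
      (Nat.factorial (n + k) : ℝ) / ((Nat.factorial n : ℝ) * (Nat.factorial k : ℝ)) := by
    rw [Nat.cast_choose ℝ (Nat.le_add_left k n), Nat.add_sub_cancel, mul_comm (Nat.factorial k : ℝ)]
  simp only [straightHermiteTerm, choose_eq]
  field_simp
  ring

theorem straightHermiteTerm_eq_zero (x t s : ℝ) {m n k : ℕ} (h : min m n < k) :
    straightHermiteTerm x t s ((m, n), k) = 0 := by
  rcases min_lt_iff.mp h with h | h <;> simp [straightHermiteTerm, Nat.choose_eq_zero_of_lt h]

theorem hasSum_straightHermiteTerm_fiber (x t s : ℝ) (p : ℕ × ℕ) :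
    HasSum (fun k => straightHermiteTerm x t s (p, k))
      (straightHermite p.1 p.2 x * t ^ p.1 * s ^ p.2 /
        ((Nat.factorial p.1 : ℝ) * (Nat.factorial p.2 : ℝ))) := by
  have h : straightHermite p.1 p.2 x * t ^ p.1 * s ^ p.2 /
      ((Nat.factorial p.1 : ℝ) * (Nat.factorial p.2 : ℝ)) =
      ∑ k ∈ Finset.range (min p.1 p.2 + 1), straightHermiteTerm x t s (p, k) := by
    simp only [straightHermite, straightHermiteTerm, Finset.sum_mul, Finset.sum_div]
  rw [h]
  refine hasSum_sum_of_ne_finset_zero fun k hk => straightHermiteTerm_eq_zero x t s ?_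
  exact Nat.lt_of_succ_le (not_lt.mp (mt Finset.mem_range.mpr hk))

theorem Real.hasSum_pow_div_factorial (y : ℝ) :
    HasSum (fun n : ℕ => y ^ n / (Nat.factorial n : ℝ)) (Real.exp y) := by
  rw [Real.exp_eq_exp_ℝ]
  exact NormedSpace.expSeries_div_hasSum_exp y

theorem Real.hasSum_mul_prod {ι κ : Type*} {f : ι → ℝ} {g : κ → ℝ} {a b : ℝ}
    (hf : HasSum f a) (hg : HasSum g b) :
    HasSum (fun q : ι × κ => f q.1 * g q.2) (a * b) :=
  hf.mul hg (summable_mul_of_summable_norm (f := f) (g := g) hf.summable.norm hg.summable.norm)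

theorem hasSum_exp_mul_exp_mul_exp (u v w : ℝ) :
    HasSum (fun q : (ℕ × ℕ) × ℕ =>
      u ^ q.1.1 / (Nat.factorial q.1.1 : ℝ) * (v ^ q.1.2 / (Nat.factorial q.1.2 : ℝ)) *
        (w ^ q.2 / (Nat.factorial q.2 : ℝ))) (Real.exp (u + v + w)) := by
  rw [Real.exp_add, Real.exp_add]
  exact Real.hasSum_mul_prod
    (Real.hasSum_mul_prod (Real.hasSum_pow_div_factorial u) (Real.hasSum_pow_div_factorial v))
    (Real.hasSum_pow_div_factorial w)

theorem shift_by_snd_injective :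
    Function.Injective fun q : (ℕ × ℕ) × ℕ => ((q.1.1 + q.2, q.1.2 + q.2), q.2) := by
  rintro ⟨⟨a, b⟩, k⟩ ⟨⟨c, d⟩, l⟩ h
  simp only [Prod.mk.injEq] at h ⊢
  omega

theorem hasSum_straightHermiteTerm (x t s : ℝ) :
    HasSum (straightHermiteTerm x t s) (Real.exp (t + s + x * t * s)) := by
  rw [← shift_by_snd_injective.hasSum_iff]
  · exact (hasSum_exp_mul_exp_mul_exp t s (x * t * s)).congr_fun fun q =>
      straightHermiteTerm_add x t s q.1.1 q.1.2 q.2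
  rintro ⟨⟨m, n⟩, k⟩ hq
  refine straightHermiteTerm_eq_zero x t s (lt_of_not_ge fun hk => hq ?_)
  obtain ⟨hm, hn⟩ := le_min_iff.mp hk
  exact ⟨((m - k, n - k), k), by simp [hm, hn]⟩

/-- The bivariate exponential generating function of the straight Hermite
polynomials is `exp (t + s + x t s)`. -/
theorem straightHermite_biEGF (x t s : ℝ) :
    HasSum
      (fun p : ℕ × ℕ =>
        straightHermite p.1 p.2 x * t ^ p.1 * s ^ p.2 /
          ((Nat.factorial p.1 : ℝ) * (Nat.factorial p.2 : ℝ)))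
      (Real.exp (t + s + x * t * s)) := by
  exact (hasSum_straightHermiteTerm x t s).prod_fiberwise
    (hasSum_straightHermiteTerm_fiber x t s)
end

section
/- For all natural numbers m, n, k, the number of k-element subsets S of (Fin m) × (Fin n) such that both the first projection and the second projection are injective on S equals C(m,k) · C(n,k) · k!. -/
open scoped Classical

/-- The partial matchings whose set of first coordinates is `A` correspond to the embeddings of
`A` into the second factor. -/
theorem card_matchings_of_image_fst_eq {α β : Type*}
    [DecidableEq α] [Fintype α] [Fintype β] (A : Finset α) :
    (Finset.univ.filter (fun S : Finset (α × β) => S.image Prod.fst = A ∧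
        (∀ a ∈ S, ∀ b ∈ S, a.1 = b.1 → a = b) ∧
        (∀ a ∈ S, ∀ b ∈ S, a.2 = b.2 → a = b))).card =
      (Fintype.card β).descFactorial A.card := by
  rw [← Fintype.card_coe A, ← Fintype.card_embedding_eq, ← Finset.card_univ]
  symm
  refine Finset.card_bij
    (fun (f : A ↪ β) _ => Finset.univ.image (fun a : A => ((a : α), f a))) ?_ ?_ ?_
  · intro f _
    simp only [Finset.mem_filter, Finset.mem_univ, true_and, Finset.mem_image]
    refine ⟨?_, ?_, ?_⟩
    · ext x
      simp
    · rintro _ ⟨x, rfl⟩ _ ⟨y, rfl⟩ h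
      rw [Subtype.ext h]
    · rintro _ ⟨x, rfl⟩ _ ⟨y, rfl⟩ h
      rw [f.injective h]
  · intro f _ g _ h
    ext x
    have hx : ((x : α), f x) ∈ Finset.univ.image (fun a : A => ((a : α), g a)) := by
      rw [← h]
      exact Finset.mem_image_of_mem _ (Finset.mem_univ x)
    obtain ⟨y, -, hy⟩ := Finset.mem_image.mp hx
    obtain ⟨hyx, hgf⟩ := Prod.mk.inj hy
    rw [← hgf, Subtype.ext hyx]
  · intro S hS
    obtain ⟨-, rfl, h₁, h₂⟩ := Finset.mem_filter.mp hS
    have hex : ∀ a : S.image Prod.fst, ∃ b, ((a : α), b) ∈ S := by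
      rintro ⟨a, ha⟩
      obtain ⟨⟨a, b⟩, hp, rfl⟩ := Finset.mem_image.mp ha
      exact ⟨b, hp⟩
    choose f hf using hex
    refine ⟨⟨f, fun x y hxy => Subtype.ext
      (congrArg Prod.fst (h₂ _ (hf x) _ (hf y) hxy))⟩, Finset.mem_univ _, ?_⟩
    ext p
    simp only [Finset.mem_image, Finset.mem_univ, true_and]
    constructor
    · rintro ⟨x, rfl⟩
      exact hf x
    · intro hp
      exact ⟨⟨p.1, Finset.mem_image_of_mem _ hp⟩, h₁ _ (hf _) _ hp rfl⟩

/-- The number of `k`-element partial matchings between `m` men and `n` women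
(subsets of `Fin m × Fin n` on which both projections are injective) is
`C(m,k) ⬝ C(n,k) ⬝ k!`. -/
theorem card_partial_matchings (m n k : ℕ) :
    ((Finset.univ : Finset (Fin m × Fin n)).powerset.filter
        (fun S => S.card = k ∧
          (∀ a ∈ S, ∀ b ∈ S, a.1 = b.1 → a = b) ∧
          (∀ a ∈ S, ∀ b ∈ S, a.2 = b.2 → a = b))).card =
      Nat.choose m k * Nat.choose n k * Nat.factorial k := by
  have card_image : ∀ S : Finset (Fin m × Fin n), (∀ a ∈ S, ∀ b ∈ S, a.1 = b.1 → a = b) →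
      (S.image Prod.fst).card = S.card := fun S h =>
    Finset.card_image_of_injOn fun a ha b hb => h a ha b hb
  rw [Finset.card_eq_sum_card_fiberwise (f := fun S => S.image Prod.fst)
    (t := Finset.powersetCard k Finset.univ)]
  · rw [Finset.sum_congr rfl (g := fun _ => n.descFactorial k)]
    · rw [Finset.sum_const, Finset.card_powersetCard, Finset.card_univ, Fintype.card_fin,
        Nat.descFactorial_eq_factorial_mul_choose, smul_eq_mul]
      ring
    · intro A hA
      obtain ⟨-, rfl⟩ := Finset.mem_powersetCard.mp hA
      have h := card_matchings_of_image_fst_eq (β := Fin n) A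
      rw [Fintype.card_fin] at h
      rw [← h]
      congr 1
      ext S
      simp only [Finset.mem_filter, Finset.mem_powerset, Finset.subset_univ, Finset.mem_univ,
        true_and]
      constructor
      · rintro ⟨⟨-, h₁, h₂⟩, hS⟩
        exact ⟨hS, h₁, h₂⟩
      · rintro ⟨hS, h₁, h₂⟩
        exact ⟨⟨by rw [← card_image S h₁, hS], h₁, h₂⟩, hS⟩
  · intro S hS
    obtain ⟨-, hk, h₁, -⟩ := Finset.mem_filter.mp hS
    exact Finset.mem_powersetCard.mpr ⟨Finset.subset_univ _, (card_image S h₁).trans hk⟩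
end
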